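/- Let h : ℝ^d → ℝ be α-Hölder for some α ∈ (0,1], let Z ~ N(0, I_d), h̄ = h − E h(Z), and for t ∈ (0,1), x ∈ ℝ^d set Z_{x,t} = √t x + √(1−t) Z. Then for every t ∈ (0,1), the map x ↦ E[ h̄(Z_{x,t}) ] is smooth, and for every multi-index i = (i₁,…,i_d) ∈ ℕ^d with |i| ≥ 1, its partial derivative ∂^{|i|}/(∂x₁^{i₁}…∂x_d^{i_d}) at x equals ( t^{|i|/2} / (1−t)^{|i|/2} ) E[ H_i(Z) h̄(Z_{x,t}) ]. -/

import Mathlib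

open MeasureTheory ProbabilityTheory Real Filter Set

noncomputable section

/-- The standard Gaussian measure `N(0, I_d)` on `ℝ^d` (as `EuclideanSpace ℝ (Fin d)`). -/
def stdGaussian (d : ℕ) : Measure (EuclideanSpace ℝ (Fin d)) :=
  (Measure.pi fun _ : Fin d => gaussianReal 0 1).map
    ⇑(EuclideanSpace.equiv (Fin d) ℝ).symm

/-- Partial derivative in the `j`-th coordinate direction. -/
def pderivI {d : ℕ} (j : Fin d) (f : EuclideanSpace ℝ (Fin d) → ℝ) :
    EuclideanSpace ℝ (Fin d) → ℝ :=
  fun x => fderiv ℝ f x (EuclideanSpace.single j 1)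

/-- Iterated partial derivative along a list of coordinate directions (head applied last,
i.e. outermost). -/
def pderivList {d : ℕ} : List (Fin d) → (EuclideanSpace ℝ (Fin d) → ℝ) →
    EuclideanSpace ℝ (Fin d) → ℝ
  | [], f => f
  | j :: l, f => pderivI j (pderivList l f)

/-- Multi-index partial derivative `∂^{|m|}/(∂x₁^{m₁} ⋯ ∂x_d^{m_d})`. -/
def pderivMulti {d : ℕ} (m : Fin d → ℕ) (f : EuclideanSpace ℝ (Fin d) → ℝ) :
    EuclideanSpace ℝ (Fin d) → ℝ :=
  pderivList ((List.finRange d).flatMap fun j => List.replicate (m j) j) f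

/-- Multivariate Hermite polynomial
`H_m(x) = (-1)^{|m|} e^{|x|²/2} ∂^{|m|}/(∂x₁^{m₁} ⋯ ∂x_d^{m_d}) e^{-|x|²/2}`. -/
def hermiteMulti {d : ℕ} (m : Fin d → ℕ) (x : EuclideanSpace ℝ (Fin d)) : ℝ :=
  (-1 : ℝ) ^ (∑ j, m j) * Real.exp (‖x‖ ^ 2 / 2) *
    pderivMulti m (fun y => Real.exp (-‖y‖ ^ 2 / 2)) x

/-- `h̄ = h - E h(Z)` with `Z ~ N(0, I_d)`. -/
def hbar (d : ℕ) (h : EuclideanSpace ℝ (Fin d) → ℝ) (x : EuclideanSpace ℝ (Fin d)) : ℝ :=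
  h x - ∫ z, h z ∂(stdGaussian d)

/-- Barbour's solution `f_h(x) = -∫₀¹ (1/(2t)) E[ h̄(√t x + √(1-t) Z) ] dt` of the
multivariate Stein equation. -/
def steinSol (d : ℕ) (h : EuclideanSpace ℝ (Fin d) → ℝ) (x : EuclideanSpace ℝ (Fin d)) : ℝ :=
  -∫ t in Ioo (0 : ℝ) 1,
      (1 / (2 * t)) *
        ∫ z, hbar d h (Real.sqrt t • x + Real.sqrt (1 - t) • z) ∂(stdGaussian d)

/-- Entry `(i, j)` of the Hessian matrix of `f` at `x`. -/
def hessEntry {d : ℕ} (f : EuclideanSpace ℝ (Fin d) → ℝ) (x : EuclideanSpace ℝ (Fin d))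
    (i j : Fin d) : ℝ :=
  pderivI i (pderivI j f) x

/-- The Hessian matrix `∇² f(x)`. -/
def hessMatrix {d : ℕ} (f : EuclideanSpace ℝ (Fin d) → ℝ) (x : EuclideanSpace ℝ (Fin d)) :
    Matrix (Fin d) (Fin d) ℝ :=
  Matrix.of fun i j => hessEntry f x i j

/-- Operator norm `‖M‖_op = sup_{|v| = 1} |M v|` (Euclidean norms) of a `d × d` matrix. -/
def matOpNorm {d : ℕ} (M : Matrix (Fin d) (Fin d) ℝ) : ℝ :=
  sSup { r | ∃ v : EuclideanSpace ℝ (Fin d), ‖v‖ = 1 ∧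
    r = ‖(WithLp.equiv 2 (Fin d → ℝ)).symm (M.mulVec ((WithLp.equiv 2 (Fin d → ℝ)) v))‖ }

/-- The Laplacian `Δ f(x) = ∑ i ∂²f/∂x_i²(x)`. -/
def laplacian {d : ℕ} (f : EuclideanSpace ℝ (Fin d) → ℝ) (x : EuclideanSpace ℝ (Fin d)) : ℝ :=
  ∑ i, hessEntry f x i i

/-- `C` is an `α`-Hölder constant for `h`. -/
def HolderConst {d : ℕ} (α C : ℝ) (h : EuclideanSpace ℝ (Fin d) → ℝ) : Prop :=
  ∀ x y, |h x - h y| ≤ C * dist x y ^ α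

/-- The 1-Wasserstein distance in dual form: sup over 1-Lipschitz test functions. -/
def wasserstein1 {d : ℕ} (μ ν : Measure (EuclideanSpace ℝ (Fin d))) : ℝ :=
  sSup { r | ∃ h : EuclideanSpace ℝ (Fin d) → ℝ, LipschitzWith 1 h ∧
    r = (∫ x, h x ∂μ) - ∫ x, h x ∂ν }

/-- The `α`-Wasserstein distance: sup over continuous `h` with `[h]_α ≤ 1`. -/
def wassersteinHolder {d : ℕ} (α : ℝ) (μ ν : Measure (EuclideanSpace ℝ (Fin d))) : ℝ :=
  sSup { r | ∃ h : EuclideanSpace ℝ (Fin d) → ℝ, Continuous h ∧ HolderConst α 1 h ∧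
    r = (∫ x, h x ∂μ) - ∫ x, h x ∂ν }

/-- The constant `C₁(α, d)`. -/
def C1 (α : ℝ) (d : ℕ) : ℝ :=
  2 ^ (α / 2 + 1) * ((α + 2 * d) / (α * d)) * Real.Gamma ((α + d) / 2) / Real.Gamma (d / 2)

/-- The constant `C₂(α, d)`. -/
def C2 (α : ℝ) (d : ℕ) : ℝ :=
  if α = 1 then 2 * Real.sqrt (2 / π) * Real.sqrt d
  else 2 ^ (α / 2 + 1) * (α + 2 * d) * Real.Gamma ((α + d) / 2) / (α * Real.Gamma (d / 2))

end

open scoped SchwartzMap LineDeriv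

section Convolution

universe u

variable {E W : Type u} [NormedAddCommGroup E] [NormedSpace ℝ E]
  [NormedAddCommGroup W] [NormedSpace ℝ W]

/-- A function of linear growth times a translated Schwartz function is dominated, locally uniformly
in the translation parameter, by an integrable power of `1 + ‖y‖`. -/
lemma exists_norm_smul_schwartz_sub_le {g : E → ℝ} {K : ℝ}
    (hg : ∀ y, |g y| ≤ K * (1 + ‖y‖)) (ψ : 𝓢(E, W)) (x₀ : E) :
    ∃ B : ℝ, ∀ x ∈ Metric.ball x₀ 1, ∀ y,
      ‖g y • ψ (y - x)‖ ≤ B * (1 + ‖y‖) ^ (-((Module.finrank ℝ E : ℝ) + 1)) := by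
  set n := Module.finrank ℝ E
  have hK : 0 ≤ K := by
    have := (abs_nonneg _).trans (hg 0)
    simpa using this
  obtain ⟨C, hC⟩ : ∃ C : ℝ, ∀ z, (1 + ‖z‖) ^ (n + 2) * ‖ψ z‖ ≤ C := by
    refine ⟨2 ^ (n + 2) * (Finset.Iic (n + 2, 0)).sup
      (fun m => SchwartzMap.seminorm ℝ m.1 m.2) ψ, fun z => ?_⟩
    have := SchwartzMap.one_add_le_sup_seminorm_apply (𝕜 := ℝ) (m := (n + 2, 0)) le_rfl le_rfl ψ z
    rwa [norm_iteratedFDeriv_zero] at this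
  refine ⟨K * (C * (2 + ‖x₀‖) ^ (n + 2)), fun x hx y => ?_⟩
  have hx' : ‖x‖ ≤ 1 + ‖x₀‖ := by
    have h1 : ‖x - x₀‖ < 1 := by simpa [dist_eq_norm] using hx
    have h2 := norm_add_le (x - x₀) x₀
    rw [sub_add_cancel] at h2
    linarith
  have hpos : 0 < 1 + ‖y‖ := by positivity
  have hy : 1 + ‖y‖ ≤ (2 + ‖x₀‖) * (1 + ‖y - x‖) := by
    have h2 := norm_add_le (y - x) x
    rw [sub_add_cancel] at h2
    nlinarith [norm_nonneg x₀, norm_nonneg (y - x)]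
  have hψ : (1 + ‖y‖) ^ (n + 2) * ‖ψ (y - x)‖ ≤ C * (2 + ‖x₀‖) ^ (n + 2) := by
    calc (1 + ‖y‖) ^ (n + 2) * ‖ψ (y - x)‖
        ≤ ((2 + ‖x₀‖) * (1 + ‖y - x‖)) ^ (n + 2) * ‖ψ (y - x)‖ := by gcongr
      _ = (2 + ‖x₀‖) ^ (n + 2) * ((1 + ‖y - x‖) ^ (n + 2) * ‖ψ (y - x)‖) := by
          rw [mul_pow, mul_assoc]
      _ ≤ (2 + ‖x₀‖) ^ (n + 2) * C := by gcongr; exact hC _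
      _ = _ := by ring
  have hrpow : (1 + ‖y‖) ^ (-((n : ℝ) + 1)) = ((1 + ‖y‖) ^ (n + 1))⁻¹ := by
    rw [Real.rpow_neg hpos.le]
    norm_cast
  rw [norm_smul, Real.norm_eq_abs, hrpow, ← div_eq_mul_inv, le_div_iff₀ (by positivity)]
  calc |g y| * ‖ψ (y - x)‖ * (1 + ‖y‖) ^ (n + 1)
      ≤ K * (1 + ‖y‖) * ‖ψ (y - x)‖ * (1 + ‖y‖) ^ (n + 1) := by gcongr; exact hg y
    _ = K * ((1 + ‖y‖) ^ (n + 2) * ‖ψ (y - x)‖) := by ring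
    _ ≤ _ := by gcongr

variable [FiniteDimensional ℝ E] [MeasurableSpace E] [BorelSpace E]
  {μ : Measure E} [μ.IsAddHaarMeasure]

lemma integrable_smul_schwartz_sub {g : E → ℝ} (hgc : Continuous g) {K : ℝ}
    (hg : ∀ y, |g y| ≤ K * (1 + ‖y‖)) (ψ : 𝓢(E, W)) (x : E) :
    Integrable (fun y => g y • ψ (y - x)) μ := by
  obtain ⟨B, hB⟩ := exists_norm_smul_schwartz_sub_le hg ψ x
  have hint : Integrable (fun y : E => B * (1 + ‖y‖) ^ (-((Module.finrank ℝ E : ℝ) + 1))) μ :=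
    (integrable_one_add_norm (by linarith)).const_mul B
  refine hint.mono' ?_ (Eventually.of_forall fun y => hB x (Metric.mem_ball_self one_pos) y)
  exact (hgc.smul (ψ.continuous.comp (continuous_id.sub continuous_const))).aestronglyMeasurable

lemma hasFDerivAt_integral_smul_schwartz_sub {g : E → ℝ} (hgc : Continuous g) {K : ℝ}
    (hg : ∀ y, |g y| ≤ K * (1 + ‖y‖)) (ψ : 𝓢(E, W)) (x : E) :
    HasFDerivAt (fun x => ∫ y, g y • ψ (y - x) ∂μ)
      (-∫ y, g y • SchwartzMap.fderivCLM ℝ E W ψ (y - x) ∂μ) x := by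
  obtain ⟨B, hB⟩ := exists_norm_smul_schwartz_sub_le hg (SchwartzMap.fderivCLM ℝ E W ψ) x
  have hint : Integrable (fun y : E => B * (1 + ‖y‖) ^ (-((Module.finrank ℝ E : ℝ) + 1))) μ :=
    (integrable_one_add_norm (by linarith)).const_mul B
  rw [← integral_neg]
  refine hasFDerivAt_integral_of_dominated_of_fderiv_le (𝕜 := ℝ)
    (F' := fun x y => -(g y • SchwartzMap.fderivCLM ℝ E W ψ (y - x)))
    (Metric.ball_mem_nhds x one_pos)
    (Eventually.of_forall fun z => (integrable_smul_schwartz_sub hgc hg ψ z).aestronglyMeasurable)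
    (integrable_smul_schwartz_sub hgc hg ψ x)
    (integrable_smul_schwartz_sub hgc hg _ x).neg.aestronglyMeasurable
    (Eventually.of_forall fun y z hz => by simpa only [norm_neg] using hB z hz y) hint
    (Eventually.of_forall fun y z _ => ?_)
  have h1 : HasFDerivAt (fun z => y - z) (-ContinuousLinearMap.id ℝ E) z :=
    (hasFDerivAt_id z).const_sub y
  have h2 := ((ψ.hasFDerivAt (y - z)).comp z h1).const_smul (g y)
  refine h2.congr_fderiv ?_
  ext v
  simp [SchwartzMap.fderivCLM_apply]

lemma contDiff_integral_smul_schwartz_sub {g : E → ℝ} (hgc : Continuous g) {K : ℝ}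
    (hg : ∀ y, |g y| ≤ K * (1 + ‖y‖)) (ψ : 𝓢(E, W)) :
    ContDiff ℝ (⊤ : ℕ∞) (fun x => ∫ y, g y • ψ (y - x) ∂μ) := by
  refine contDiff_infty.2 fun n => ?_
  induction n generalizing W with
  | zero =>
    rw [Nat.cast_zero, contDiff_zero, continuous_iff_continuousAt]
    exact fun x => (hasFDerivAt_integral_smul_schwartz_sub hgc hg ψ x).continuousAt
  | succ n ih =>
    rw [Nat.cast_succ]
    exact contDiff_succ_iff_hasFDerivAt.2
      ⟨_, (ih (SchwartzMap.fderivCLM ℝ E W ψ)).neg,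
        hasFDerivAt_integral_smul_schwartz_sub hgc hg ψ⟩

lemma fderiv_integral_smul_schwartz_sub_apply [CompleteSpace W] {g : E → ℝ} (hgc : Continuous g)
    {K : ℝ} (hg : ∀ y, |g y| ≤ K * (1 + ‖y‖)) (ψ : 𝓢(E, W)) (x v : E) :
    fderiv ℝ (fun x => ∫ y, g y • ψ (y - x) ∂μ) x v =
      -∫ y, g y • (∂_{v} ψ) (y - x) ∂μ := by
  rw [(hasFDerivAt_integral_smul_schwartz_sub hgc hg ψ x).fderiv, neg_apply,
    ContinuousLinearMap.integral_apply (integrable_smul_schwartz_sub hgc hg _ x)]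
  rfl

end Convolution

section Gaussian

variable {E : Type*} [NormedAddCommGroup E] [InnerProductSpace ℝ E]

lemma hasTemperateGrowth_neg_norm_sq_div_two :
    Function.HasTemperateGrowth (fun x : E => -‖x‖ ^ 2 / 2) := by
  have h : (fun x : E => -‖x‖ ^ 2 / 2) = fun x => (-1 / 2 : ℝ) * innerSL ℝ x x := by
    ext x
    rw [innerSL_apply_apply, real_inner_self_eq_norm_sq]
    ring
  rw [h]
  exact (Function.HasTemperateGrowth.const _).mul
    ((innerSL ℝ).bilinear_hasTemperateGrowth .id' .id')

lemma exists_one_add_pow_mul_exp_neg_sq_le (k : ℕ) :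
    ∃ C : ℝ, ∀ r : ℝ, 0 ≤ r → (1 + r) ^ k * Real.exp (-r ^ 2 / 2) ≤ C := by
  refine ⟨k.factorial * Real.exp (3 / 2), fun r hr => ?_⟩
  have h1 : (1 + r) ^ k ≤ k.factorial * Real.exp (1 + r) := by
    have := Real.pow_div_factorial_le_exp (1 + r) (by positivity) k
    rwa [div_le_iff₀ (by positivity), mul_comm] at this
  calc (1 + r) ^ k * Real.exp (-r ^ 2 / 2)
      ≤ k.factorial * Real.exp (1 + r) * Real.exp (-r ^ 2 / 2) := by gcongr
    _ = k.factorial * Real.exp (1 + r + -r ^ 2 / 2) := by rw [mul_assoc, ← Real.exp_add]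
    _ ≤ k.factorial * Real.exp (3 / 2) := by gcongr; nlinarith [sq_nonneg (r - 1)]

variable (E) in
/-- The Gaussian `x ↦ exp (-‖x‖² / 2)` as a Schwartz function. -/
noncomputable def gaussianSchwartz : 𝓢(E, ℝ) where
  toFun x := Real.exp (-‖x‖ ^ 2 / 2)
  smooth' := Real.contDiff_exp.comp hasTemperateGrowth_neg_norm_sq_div_two.1
  decay' k n := by
    obtain ⟨l, C, hC, hf⟩ :=
      (hasTemperateGrowth_neg_norm_sq_div_two (E := E)).norm_iteratedFDeriv_le_uniform n
    obtain ⟨M, hM⟩ := exists_one_add_pow_mul_exp_neg_sq_le (k + l * n)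
    refine ⟨n.factorial * (1 + C) ^ n * M, fun x => ?_⟩
    have h1 : ‖iteratedFDeriv ℝ n (Real.exp ∘ fun x : E => -‖x‖ ^ 2 / 2) x‖ ≤
        n.factorial * Real.exp (-‖x‖ ^ 2 / 2) * ((1 + C) * (1 + ‖x‖) ^ l) ^ n := by
      refine norm_iteratedFDeriv_comp_le (N := (⊤ : ℕ∞)) Real.contDiff_exp
        hasTemperateGrowth_neg_norm_sq_div_two.1 (by exact_mod_cast le_top) x
        (fun i _ => ?_) (fun i hi hin => ?_)
      · rw [norm_iteratedFDeriv_eq_norm_iteratedDeriv, iteratedDeriv_eq_iterate,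
          Real.iter_deriv_exp, Real.norm_eq_abs, Real.abs_exp]
      · have hone : 1 ≤ (1 + C) * (1 + ‖x‖) ^ l :=
          one_le_mul_of_one_le_of_one_le (by linarith)
            (one_le_pow₀ (by linarith [norm_nonneg x]))
        calc _ ≤ C * (1 + ‖x‖) ^ l := hf i hin x
          _ ≤ (1 + C) * (1 + ‖x‖) ^ l := by gcongr; linarith
          _ ≤ _ := le_self_pow₀ hone (by omega)
    calc ‖x‖ ^ k * ‖iteratedFDeriv ℝ n (fun x : E => Real.exp (-‖x‖ ^ 2 / 2)) x‖
        ≤ (1 + ‖x‖) ^ k *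
          (n.factorial * Real.exp (-‖x‖ ^ 2 / 2) * ((1 + C) * (1 + ‖x‖) ^ l) ^ n) := by
          gcongr
          · linarith
          · exact h1
      _ = n.factorial * (1 + C) ^ n *
          ((1 + ‖x‖) ^ (k + l * n) * Real.exp (-‖x‖ ^ 2 / 2)) := by
          rw [mul_pow, ← pow_mul, pow_add]
          ring
      _ ≤ _ := by gcongr; exact hM _ (norm_nonneg x)

lemma gaussianSchwartz_apply (x : E) : gaussianSchwartz E x = Real.exp (-‖x‖ ^ 2 / 2) := rfl

end Gaussian

lemma pi_gaussianReal_eq_withDensity (d : ℕ) :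
    (Measure.pi fun _ : Fin d => gaussianReal 0 1) =
      volume.withDensity fun x => ENNReal.ofReal (∏ i, gaussianPDFReal 0 1 (x i)) := by
  refine Measure.pi_eq fun s hs => ?_
  have hind : ∀ i, Integrable ((s i).indicator (gaussianPDFReal 0 1)) volume := fun i =>
    (integrable_gaussianPDFReal 0 1).indicator (hs i)
  have hpos : ∀ i x, 0 ≤ (s i).indicator (gaussianPDFReal 0 1) x := fun i x =>
    indicator_nonneg (fun x _ => gaussianPDFReal_nonneg 0 1 x) x
  have hprod : (Set.univ.pi s).indicator
      (fun x : Fin d → ℝ => ENNReal.ofReal (∏ i, gaussianPDFReal 0 1 (x i))) =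
      fun x => ENNReal.ofReal (∏ i, (s i).indicator (gaussianPDFReal 0 1) (x i)) := by
    ext x
    by_cases hx : x ∈ Set.univ.pi s
    · rw [indicator_of_mem hx]
      congr 1
      exact Finset.prod_congr rfl fun i _ => (indicator_of_mem (hx i trivial) _).symm
    · rw [indicator_of_notMem hx]
      obtain ⟨i, hi⟩ : ∃ i, x i ∉ s i := by simpa using hx
      rw [Finset.prod_eq_zero (Finset.mem_univ i) (indicator_of_notMem hi _), ENNReal.ofReal_zero]
  have hms : MeasurableSet (Set.univ.pi s) := MeasurableSet.univ_pi hs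
  rw [withDensity_apply _ hms, ← lintegral_indicator hms, hprod,
    ← ofReal_integral_eq_lintegral_ofReal (μ := volume) (Integrable.fintype_prod hind)
      (Eventually.of_forall fun x => Finset.prod_nonneg fun i _ => hpos i _),
    integral_fintype_prod_volume_eq_prod (fun i => (s i).indicator (gaussianPDFReal 0 1)),
    ENNReal.ofReal_prod_of_nonneg fun i _ => integral_nonneg (hpos i)]
  refine Finset.prod_congr rfl fun i _ => ?_
  rw [gaussianReal_apply_eq_integral 0 one_ne_zero, integral_indicator (hs i)]

lemma integral_stdGaussian (d : ℕ) (f : EuclideanSpace ℝ (Fin d) → ℝ) :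
    ∫ z, f z ∂(stdGaussian d) =
      (√(2 * π))⁻¹ ^ d * ∫ z, Real.exp (-‖z‖ ^ 2 / 2) * f z := by
  have hpdf : ∀ x : Fin d → ℝ, ∏ i, gaussianPDFReal 0 1 (x i) =
      (√(2 * π))⁻¹ ^ d * Real.exp (-‖WithLp.toLp 2 x‖ ^ 2 / 2) := by
    intro x
    simp only [gaussianPDFReal, Finset.prod_mul_distrib, Finset.prod_const, Finset.card_univ,
      Fintype.card_fin, ← Real.exp_sum, EuclideanSpace.real_norm_sq_eq]
    simp [Finset.sum_div, neg_div]
  have hmeas : Measurable fun x : Fin d → ℝ => ∏ i, gaussianPDFReal 0 1 (x i) :=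
    Finset.measurable_prod _ fun i _ => (measurable_gaussianPDFReal 0 1).comp (measurable_pi_apply i)
  have hmap : stdGaussian d = (Measure.pi fun _ : Fin d => gaussianReal 0 1).map
      (MeasurableEquiv.toLp 2 (Fin d → ℝ)) := rfl
  rw [hmap, integral_map_equiv, pi_gaussianReal_eq_withDensity,
    integral_withDensity_eq_integral_toReal_smul hmeas.ennreal_ofReal
      (Eventually.of_forall fun x => ENNReal.ofReal_lt_top),
    ← (PiLp.volume_preserving_toLp (Fin d)).integral_comp
      (MeasurableEquiv.toLp 2 (Fin d → ℝ)).measurableEmbedding, ← integral_const_mul]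
  refine integral_congr_ae (Eventually.of_forall fun x => ?_)
  simp only [smul_eq_mul]
  rw [ENNReal.toReal_ofReal (Finset.prod_nonneg fun i _ => gaussianPDFReal_nonneg 0 1 _), hpdf,
    mul_assoc]
  rfl

section PartialDerivatives

variable {d : ℕ}

/-- Iterated partial derivative of a Schwartz function along a list of coordinate directions. -/
noncomputable def schwartzPderivList : List (Fin d) → 𝓢(EuclideanSpace ℝ (Fin d), ℝ) →
    𝓢(EuclideanSpace ℝ (Fin d), ℝ)
  | [], ψ => ψ
  | j :: l, ψ => ∂_{(EuclideanSpace.single j 1 : EuclideanSpace ℝ (Fin d))} (schwartzPderivList l ψ)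

lemma pderivList_schwartz (l : List (Fin d)) (ψ : 𝓢(EuclideanSpace ℝ (Fin d), ℝ)) :
    pderivList l ψ = schwartzPderivList l ψ := by
  induction l with
  | nil => rfl
  | cons j l ih =>
    rw [pderivList, ih]
    rfl

lemma pderivList_integral_smul_schwartz_sub {g : EuclideanSpace ℝ (Fin d) → ℝ}
    (hgc : Continuous g) {K : ℝ} (hg : ∀ y, |g y| ≤ K * (1 + ‖y‖))
    (ψ : 𝓢(EuclideanSpace ℝ (Fin d), ℝ)) (c k : ℝ) (l : List (Fin d)) :
    pderivList l (fun x => c * ∫ y, g y • ψ (y - k • x)) =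
      fun x => c * (-k) ^ l.length * ∫ y, g y • schwartzPderivList l ψ (y - k • x) := by
  induction l with
  | nil => simp [pderivList, schwartzPderivList]
  | cons j l ih =>
    rw [pderivList, ih]
    ext x
    have hG := hasFDerivAt_integral_smul_schwartz_sub (μ := volume) hgc hg
      (schwartzPderivList l ψ) (k • x)
    have hk : HasFDerivAt (fun x : EuclideanSpace ℝ (Fin d) => k • x)
        (k • ContinuousLinearMap.id ℝ _) x := (hasFDerivAt_id x).const_smul k
    have h := (hG.comp x hk).const_mul (c * (-k) ^ l.length)
    have hv := fderiv_integral_smul_schwartz_sub_apply (μ := volume) hgc hg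
      (schwartzPderivList l ψ) (k • x) (EuclideanSpace.single j 1)
    rw [hG.fderiv] at hv
    rw [pderivI]
    refine (congrArg (fun L => L (EuclideanSpace.single j 1)) h.fderiv).trans ?_
    simp only [smul_apply, ContinuousLinearMap.comp_apply,
      ContinuousLinearMap.id_apply, map_smul, hv, smul_eq_mul, List.length_cons, schwartzPderivList]
    ring

end PartialDerivatives

section Holder

variable {d : ℕ} {α : ℝ} {h : EuclideanSpace ℝ (Fin d) → ℝ} {C : ℝ}

lemma HolderConst.continuous (hα : 0 < α) (hC : HolderConst α C h) : Continuous h := by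
  refine continuous_iff_continuousAt.2 fun x => ?_
  refine tendsto_iff_dist_tendsto_zero.2 ?_
  have hlim : Tendsto (fun y => C * dist y x ^ α) (nhds x) (nhds 0) := by
    have : ContinuousAt (fun y => C * dist y x ^ α) x :=
      continuousAt_const.mul
        ((continuous_id.dist continuous_const).continuousAt.rpow_const (Or.inr hα.le))
    simpa [ContinuousAt, Real.zero_rpow hα.ne'] using this
  exact squeeze_zero (fun _ => dist_nonneg) (fun y => by simpa [Real.dist_eq] using hC y x) hlim

lemma HolderConst.exists_abs_sub_const_le (hα : α ∈ Set.Ioc (0 : ℝ) 1) (hC : HolderConst α C h)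
    (a : ℝ) : ∃ K, 0 ≤ K ∧ ∀ y, |h y - a| ≤ K * (1 + ‖y‖) := by
  refine ⟨|h 0 - a| + |C|, by positivity, fun y => ?_⟩
  have h1 : dist y 0 ^ α ≤ 1 + ‖y‖ := by
    rw [dist_zero_right]
    calc ‖y‖ ^ α ≤ (1 + ‖y‖) ^ α :=
          Real.rpow_le_rpow (norm_nonneg y) (by linarith) hα.1.le
      _ ≤ (1 + ‖y‖) ^ (1 : ℝ) :=
          Real.rpow_le_rpow_of_exponent_le (by linarith [norm_nonneg y]) hα.2
      _ = 1 + ‖y‖ := Real.rpow_one _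
  calc |h y - a| = |(h y - h 0) + (h 0 - a)| := by ring_nf
    _ ≤ |h y - h 0| + |h 0 - a| := abs_add_le _ _
    _ ≤ |C| * (1 + ‖y‖) + |h 0 - a| * (1 + ‖y‖) := by
        gcongr
        · exact (hC y 0).trans (mul_le_mul (le_abs_self C) h1 (by positivity) (abs_nonneg C))
        · exact le_mul_of_one_le_right (abs_nonneg _) (by linarith [norm_nonneg y])
    _ = _ := by ring

end Holder

lemma integral_smul_comp_add_smul_eq {d : ℕ} (g ψ : EuclideanSpace ℝ (Fin d) → ℝ) {s r : ℝ}
    (hr : r ≠ 0) (x : EuclideanSpace ℝ (Fin d)) :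
    ∫ z, ψ z * g (s • x + r • z) = ∫ y, g (r • y) • ψ (y - (s / r) • x) := by
  rw [← integral_add_right_eq_self (fun y => g (r • y) • ψ (y - (s / r) • x)) ((s / r) • x)]
  congr 1
  ext z
  rw [add_sub_cancel_right, smul_add, smul_smul, mul_div_cancel₀ _ hr, add_comm, smul_eq_mul,
    mul_comm]

lemma length_flatMap_replicate {d : ℕ} (m : Fin d → ℕ) :
    ((List.finRange d).flatMap fun j => List.replicate (m j) j).length = ∑ j, m j := by
  simp [List.length_flatMap, ← List.ofFn_eq_map, List.sum_ofFn]

/-- **Display (2.4)**: for `α`-Hölder `h` and `t ∈ (0,1)`, the map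
`x ↦ E[h̄(Z_{x,t})]` is smooth and its multi-index partial derivatives are
`(t/(1-t))^{|m|/2} E[H_m(Z) h̄(Z_{x,t})]`. -/
theorem ou_semigroup_smooth_and_deriv_formula
    {d : ℕ} (hd : 1 ≤ d) {α : ℝ} (hα : α ∈ Set.Ioc (0 : ℝ) 1)
    (h : EuclideanSpace ℝ (Fin d) → ℝ) (hC : ∃ C : ℝ, HolderConst α C h)
    (t : ℝ) (ht : t ∈ Set.Ioo (0 : ℝ) 1) :
    ContDiff ℝ (⊤ : ℕ∞)
        (fun x : EuclideanSpace ℝ (Fin d) =>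
          ∫ z, hbar d h (Real.sqrt t • x + Real.sqrt (1 - t) • z) ∂(stdGaussian d)) ∧
      ∀ m : Fin d → ℕ, 1 ≤ ∑ j, m j → ∀ x,
        pderivMulti m
            (fun y =>
              ∫ z, hbar d h (Real.sqrt t • y + Real.sqrt (1 - t) • z) ∂(stdGaussian d)) x =
          (t ^ (((∑ j, m j : ℕ) : ℝ) / 2) / (1 - t) ^ (((∑ j, m j : ℕ) : ℝ) / 2)) *
            ∫ z, hermiteMulti m z *
              hbar d h (Real.sqrt t • x + Real.sqrt (1 - t) • z) ∂(stdGaussian d) := by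
  obtain ⟨C, hC⟩ := hC
  set g : EuclideanSpace ℝ (Fin d) → ℝ := hbar d h
  set s := √t with hs
  set r := √(1 - t) with hr
  have hr0 : 0 < r := Real.sqrt_pos.2 (by linarith [ht.2])
  obtain ⟨K, hK0, hK⟩ := hC.exists_abs_sub_const_le hα (∫ z, h z ∂(stdGaussian d))
  have hgc : Continuous fun y => g (r • y) :=
    ((hC.continuous hα.1).sub continuous_const).comp (continuous_const_smul r)
  have hgK : ∀ y, |g (r • y)| ≤ K * (1 + r) * (1 + ‖y‖) := fun y => by
    refine (hK (r • y)).trans ?_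
    rw [norm_smul, Real.norm_of_nonneg hr0.le, mul_assoc]
    gcongr
    nlinarith [norm_nonneg y]
  set c := (√(2 * π))⁻¹ ^ d
  set Φ := gaussianSchwartz (EuclideanSpace ℝ (Fin d))
  have hF : (fun x => ∫ z, g (s • x + r • z) ∂(stdGaussian d)) =
      fun x => c * ∫ y, g (r • y) • Φ (y - (s / r) • x) := by
    ext x
    rw [integral_stdGaussian, ← integral_smul_comp_add_smul_eq g Φ hr0.ne' x]
    rfl
  rw [hF]
  refine ⟨contDiff_const.mul ((contDiff_integral_smul_schwartz_sub hgc hgK Φ).comp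
    (contDiff_const_smul (s / r))), fun m _ x => ?_⟩
  have hH : ∀ z, Real.exp (-‖z‖ ^ 2 / 2) * (hermiteMulti m z * g (s • x + r • z)) =
      (-1) ^ (∑ j, m j) * (schwartzPderivList
        ((List.finRange d).flatMap fun j => List.replicate (m j) j) Φ z *
          g (s • x + r • z)) := fun z => by
    have hexp : Real.exp (-‖z‖ ^ 2 / 2) * Real.exp (‖z‖ ^ 2 / 2) = 1 := by
      rw [← Real.exp_add, neg_div, neg_add_cancel, Real.exp_zero]
    have hp : pderivMulti m (fun y => Real.exp (-‖y‖ ^ 2 / 2)) z = schwartzPderivList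
        ((List.finRange d).flatMap fun j => List.replicate (m j) j) Φ z :=
      congrFun (pderivList_schwartz _ Φ) z
    rw [hermiteMulti, hp]
    linear_combination ((-1) ^ (∑ j, m j) * schwartzPderivList
        ((List.finRange d).flatMap fun j => List.replicate (m j) j) Φ z *
          g (s • x + r • z)) * hexp
  rw [integral_stdGaussian, integral_congr_ae (Eventually.of_forall hH), integral_const_mul,
    integral_smul_comp_add_smul_eq g _ hr0.ne' x, pderivMulti,
    pderivList_integral_smul_schwartz_sub hgc hgK, length_flatMap_replicate]
  have hpow : ∀ a : ℝ, 0 ≤ a → ∀ n : ℕ, a ^ ((n : ℝ) / 2) = √a ^ n := fun a ha n => by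
    rw [Real.sqrt_eq_rpow, ← Real.rpow_mul_natCast ha]
    congr 1
    ring
  rw [hpow t ht.1.le, hpow (1 - t) (by linarith [ht.2]), ← hs, ← hr, ← div_pow, neg_pow]
  ring
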